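/- Let V be a finite-dimensional complex vector space of dimension 2n with n ≥ 1, and let σ be a nondegenerate alternating 2-form on V (an element of the second exterior power of the dual space V* such that for every nonzero v ∈ V there exists w ∈ V with σ(v, w) ≠ 0). Then the linear map from ⋀¹V* to ⋀^{2n−1}V* given by wedging with the (n−1)-st exterior power of σ, i.e. φ ↦ σ^{n−1} ∧ φ, is a linear isomorphism. -/

import Mathlib

open ExteriorAlgebra Module

set_option synthInstance.maxHeartbeats 400000
set_option maxHeartbeats 1000000

/-- Evaluation of an element of the exterior algebra of the dual space at a pair of
vectors `(v, w)`.  On a decomposable element `f ∧ g` (with `f g : V*`) it returns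
`f v * g w - f w * g v`, so its restriction to the second exterior power
`⋀[ℂ]^2 (Module.Dual ℂ V)` is the usual interpretation of a `2`-vector of the dual as an
alternating bilinear form on `V`. -/
noncomputable def exteriorEvalPair {V : Type*} [AddCommGroup V] [Module ℂ V] (v w : V) :
    ExteriorAlgebra ℂ (Module.Dual ℂ V) →ₗ[ℂ] ℂ :=
  ExteriorAlgebra.liftAlternating fun i =>
    match i with
    | 2 => (Matrix.detRowAlternating (n := Fin 2) (R := ℂ)).compLinearMap
        (LinearMap.pi fun j : Fin 2 => LinearMap.applyₗ (![v, w] j))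
    | _ => 0

namespace WedgeAux

variable {V : Type*} [AddCommGroup V] [Module ℂ V]

/-- Contraction (interior product) with a vector, linear in the vector. -/
noncomputable def con : V →ₗ[ℂ] ExteriorAlgebra ℂ (Module.Dual ℂ V) →ₗ[ℂ]
    ExteriorAlgebra ℂ (Module.Dual ℂ V) :=
  (CliffordAlgebra.contractLeft (Q := (0 : QuadraticForm ℂ (Module.Dual ℂ V)))) ∘ₗ
    Module.Dual.eval ℂ V

lemma con_mul (v : V) (f : Module.Dual ℂ V) (x : ExteriorAlgebra ℂ (Module.Dual ℂ V)) :
    con v (ι ℂ f * x) = f v • x - ι ℂ f * con v x :=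
  CliffordAlgebra.contractLeft_ι_mul _ _ _

lemma con_algebraMap (v : V) (r : ℂ) :
    con v (algebraMap ℂ (ExteriorAlgebra ℂ (Module.Dual ℂ V)) r) = 0 :=
  CliffordAlgebra.contractLeft_algebraMap _ _ _

lemma con_iota (v : V) (f : Module.Dual ℂ V) :
    con v (ι ℂ f) = algebraMap ℂ (ExteriorAlgebra ℂ (Module.Dual ℂ V)) (f v) :=
  CliffordAlgebra.contractLeft_ι _ _ _

lemma swap (f g : Module.Dual ℂ V) : ι ℂ f * ι ℂ g = -(ι ℂ g * ι ℂ f) :=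
  eq_neg_of_add_eq_zero_left (ι_add_mul_swap f g)

/-- Induction principle for two-forms. -/
lemma two_ind {P : ∀ x : ExteriorAlgebra ℂ (Module.Dual ℂ V),
      x ∈ ⋀[ℂ]^2 (Module.Dual ℂ V) → Prop}
    (h : ∀ (f g : Module.Dual ℂ V) (hfg : ι ℂ f * ι ℂ g ∈ ⋀[ℂ]^2 (Module.Dual ℂ V)),
      P (ι ℂ f * ι ℂ g) hfg)
    (hadd : ∀ x y hx hy, P x hx → P y hy → P (x + y) (add_mem hx hy))
    {σ : ExteriorAlgebra ℂ (Module.Dual ℂ V)} (hσ : σ ∈ ⋀[ℂ]^2 (Module.Dual ℂ V)) : P σ hσ := by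
  have key : ∃ h, P σ h := by
    have hσ' := hσ
    unfold exteriorPower at hσ'
    rw [pow_two] at hσ'
    refine Submodule.mul_induction_on (C := fun x => ∃ h, P x h) hσ' ?_ ?_
    · rintro _ ⟨f, rfl⟩ _ ⟨g, rfl⟩
      refine ⟨?_, h f g _⟩
      unfold exteriorPower
      rw [pow_two]
      exact Submodule.mul_mem_mul ⟨f, rfl⟩ ⟨g, rfl⟩
    · rintro x y ⟨hx, h1⟩ ⟨hy, h2⟩
      exact ⟨_, hadd x y hx hy h1 h2⟩
  exact key.2

lemma con_two_mul (v : V) {σ : ExteriorAlgebra ℂ (Module.Dual ℂ V)}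
    (hσ : σ ∈ ⋀[ℂ]^2 (Module.Dual ℂ V)) (x : ExteriorAlgebra ℂ (Module.Dual ℂ V)) :
    con v (σ * x) = con v σ * x + σ * con v x := by
  induction hσ using two_ind with
  | h f g _ =>
    simp only [mul_assoc, con_mul, con_iota, Algebra.algebraMap_eq_smul_one, sub_mul, mul_sub,
      smul_mul_assoc, mul_smul_comm, mul_one]
    abel
  | hadd x y _ _ hx hy => simp only [add_mul, map_add, hx, hy]; abel

lemma two_comm (f : Module.Dual ℂ V) {σ : ExteriorAlgebra ℂ (Module.Dual ℂ V)}
    (hσ : σ ∈ ⋀[ℂ]^2 (Module.Dual ℂ V)) : Commute σ (ι ℂ f) := by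
  induction hσ using two_ind with
  | h a b _ =>
    show _ = _
    rw [mul_assoc, swap b f, mul_neg, ← mul_assoc, swap a f, neg_mul, neg_neg, mul_assoc]
  | hadd x y _ _ hx hy => exact hx.add_left hy

lemma con_two_mem (v : V) {σ : ExteriorAlgebra ℂ (Module.Dual ℂ V)}
    (hσ : σ ∈ ⋀[ℂ]^2 (Module.Dual ℂ V)) :
    con v σ ∈ LinearMap.range (ι ℂ : Module.Dual ℂ V →ₗ[ℂ] _) := by
  induction hσ using two_ind with
  | h a b _ =>
    refine ⟨a v • b - b v • a, ?_⟩
    simp only [con_mul, con_iota, map_sub, map_smul, Algebra.algebraMap_eq_smul_one,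
      mul_smul_comm, mul_one]
  | hadd x y _ _ hx hy => rw [map_add]; exact add_mem hx hy

lemma con_con (v w : V) {σ : ExteriorAlgebra ℂ (Module.Dual ℂ V)}
    (hσ : σ ∈ ⋀[ℂ]^2 (Module.Dual ℂ V)) :
    con w (con v σ) = algebraMap ℂ _ (exteriorEvalPair v w σ) := by
  induction hσ using two_ind with
  | h a b _ =>
    have h2 : ι ℂ a * ι ℂ b = ιMulti ℂ 2 ![a, b] := by simp [ιMulti_apply]
    have : exteriorEvalPair v w (ι ℂ a * ι ℂ b) = a v * b w - a w * b v := by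
      rw [h2, exteriorEvalPair, liftAlternating_apply_ιMulti]
      exact (Matrix.det_fin_two _).trans (by simp)
    rw [this]
    simp only [con_mul, con_iota, map_sub, map_smul, Algebra.algebraMap_eq_smul_one,
      mul_smul_comm, mul_one, smul_smul, sub_smul]
    rw [mul_comm (b v)]
  | hadd x y _ _ hx hy => simp only [map_add, hx, hy]

lemma con_pow (v : V) {σ : ExteriorAlgebra ℂ (Module.Dual ℂ V)}
    (hσ : σ ∈ ⋀[ℂ]^2 (Module.Dual ℂ V)) (k : ℕ) :
    con v (σ ^ (k + 1)) = ((k : ℂ) + 1) • (con v σ * σ ^ k) := by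
  obtain ⟨f, hf⟩ := con_two_mem v hσ
  induction k with
  | zero => simp
  | succ k ih =>
    rw [pow_succ', con_two_mul v hσ, ih, ← hf, mul_smul_comm, ← mul_assoc,
      (two_comm f hσ).eq, mul_assoc, ← pow_succ', Nat.cast_succ, add_smul ((k : ℂ) + 1), one_smul,
      add_comm]

lemma euler {I : Type*} [Fintype I] (b : Basis I ℂ V) (m : ℕ)
    {x : ExteriorAlgebra ℂ (Module.Dual ℂ V)} (hx : x ∈ ⋀[ℂ]^m (Module.Dual ℂ V)) :
    ∑ i, ι ℂ (b.coord i) * con (b i) x = (m : ℂ) • x := by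
  induction hx using Submodule.pow_induction_on_left' with
  | algebraMap r => simp [con_algebraMap]
  | add x y i hx hy h1 h2 => simp only [map_add, mul_add, Finset.sum_add_distrib, h1, h2, smul_add]
  | mem_mul m hm i x hx h =>
    obtain ⟨f, rfl⟩ := hm
    have h1 : ∑ i, f (b i) • ι ℂ (b.coord i) = ι ℂ f := by
      conv_rhs => rw [← b.sum_dual_apply_smul_coord f]
      simp only [map_sum, map_smul]
    have h2 : ∀ i, ι ℂ (b.coord i) * con (b i) (ι ℂ f * x) =
        (f (b i) • ι ℂ (b.coord i)) * x + ι ℂ f * (ι ℂ (b.coord i) * con (b i) x) := by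
      intro i
      rw [con_mul, mul_sub, ← mul_assoc, swap, neg_mul, sub_neg_eq_add, mul_assoc, mul_smul_comm,
        smul_mul_assoc]
    simp only [h2, Finset.sum_add_distrib, ← Finset.mul_sum, ← Finset.sum_mul, h1, h,
      mul_smul_comm, Nat.succ_eq_add_one, Nat.cast_add, Nat.cast_one, add_smul, one_smul]
    rw [add_comm]

lemma eq_zero_of_wedge [FiniteDimensional ℂ V] (m : ℕ) (hm : m < finrank ℂ V)
    {x : ExteriorAlgebra ℂ (Module.Dual ℂ V)} (hx : x ∈ ⋀[ℂ]^m (Module.Dual ℂ V))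
    (h : ∀ f : Module.Dual ℂ V, ι ℂ f * x = 0) : x = 0 := by
  let b := Module.finBasis ℂ V
  have h1 : ∀ i, x = ι ℂ (b.coord i) * con (b i) x := by
    intro i
    have := con_mul (b i) (b.coord i) x
    rw [h, map_zero] at this
    simpa [sub_eq_zero] using this.symm
  have h2 := euler b m hx
  simp only [← h1, Finset.sum_const, Finset.card_univ, Fintype.card_fin] at h2
  rw [← Nat.cast_smul_eq_nsmul ℂ, ← sub_eq_zero, ← sub_smul, smul_eq_zero, sub_eq_zero] at h2
  rcases h2 with h2 | h2
  · exact absurd (Nat.cast_injective h2) (by omega)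
  · exact h2

lemma pow_mem {σ : ExteriorAlgebra ℂ (Module.Dual ℂ V)}
    (hσ : σ ∈ ⋀[ℂ]^2 (Module.Dual ℂ V)) (k : ℕ) : σ ^ k ∈ ⋀[ℂ]^(2 * k) (Module.Dual ℂ V) := by
  unfold exteriorPower at *
  rw [pow_mul]
  exact Submodule.pow_mem_pow _ hσ k

lemma exists_con [FiniteDimensional ℂ V]
    {σ : ExteriorAlgebra ℂ (Module.Dual ℂ V)} (hσ : σ ∈ ⋀[ℂ]^2 (Module.Dual ℂ V))
    (hnd : ∀ v : V, v ≠ 0 → ∃ w : V, exteriorEvalPair v w σ ≠ 0) (f : Module.Dual ℂ V) :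
    ∃ v : V, con v σ = ι ℂ f := by
  have hinj : Function.Injective (con.flip σ : V →ₗ[ℂ] _) := by
    rw [← LinearMap.ker_eq_bot, LinearMap.ker_eq_bot']
    intro v hv
    by_contra hne
    obtain ⟨w, hw⟩ := hnd v hne
    have := con_con v w hσ
    rw [LinearMap.flip_apply] at hv
    rw [hv, map_zero] at this
    exact hw ((algebraMap_eq_zero_iff _ _).1 this.symm)
  have hle : LinearMap.range (con.flip σ : V →ₗ[ℂ] _) ≤
      LinearMap.range (ι ℂ : Module.Dual ℂ V →ₗ[ℂ] _) := by
    rintro _ ⟨v, rfl⟩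
    exact con_two_mem v hσ
  have heq := Submodule.eq_of_le_of_finrank_eq hle (by
    rw [LinearMap.finrank_range_of_inj hinj, LinearMap.finrank_range_of_inj ι_leftInverse.injective,
      Subspace.dual_finrank_eq])
  have : ι ℂ f ∈ LinearMap.range (con.flip σ : V →ₗ[ℂ] _) := heq ▸ ⟨f, rfl⟩
  exact this

lemma pow_ne_zero' [FiniteDimensional ℂ V] (n : ℕ) (hdim : Module.finrank ℂ V = 2 * n)
    {σ : ExteriorAlgebra ℂ (Module.Dual ℂ V)} (hσ : σ ∈ ⋀[ℂ]^2 (Module.Dual ℂ V))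
    (hnd : ∀ v : V, v ≠ 0 → ∃ w : V, exteriorEvalPair v w σ ≠ 0) (k : ℕ) (hk : k ≤ n) :
    σ ^ k ≠ 0 := by
  induction k with
  | zero => simp
  | succ k ih =>
    intro h0
    refine ih (by omega) (eq_zero_of_wedge (2 * k) (by omega) (pow_mem hσ k) fun f => ?_)
    obtain ⟨v, hv⟩ := exists_con hσ hnd f
    have := con_pow v hσ k
    rw [h0, map_zero, hv] at this
    exact (smul_eq_zero.1 this.symm).resolve_left (Nat.cast_add_one_ne_zero k)

end WedgeAux

/-- Let `V` be a finite-dimensional complex vector space of dimension `2n` (`n ≥ 1`) and `σ` a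
nondegenerate alternating `2`-form on `V`, i.e. an element of `⋀^2 V*` such that for every
`v ≠ 0` there is `w` with `σ(v, w) ≠ 0`.  Then the linear map `⋀^1 V* → ⋀^(2n-1) V*`,
`φ ↦ σ^(n-1) ∧ φ`, is a linear isomorphism: it is injective and its range is exactly
`⋀^(2n-1) V*`. -/
theorem wedge_pow_symplectic_one_form_bijective
    {V : Type*} [AddCommGroup V] [Module ℂ V] [FiniteDimensional ℂ V]
    (n : ℕ) (hn : 1 ≤ n) (hdim : Module.finrank ℂ V = 2 * n)
    (σ : ExteriorAlgebra ℂ (Module.Dual ℂ V)) (hσ : σ ∈ ⋀[ℂ]^2 (Module.Dual ℂ V))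
    (hnd : ∀ v : V, v ≠ 0 → ∃ w : V, exteriorEvalPair v w σ ≠ 0) :
    Function.Injective
        (LinearMap.mulLeft ℂ (σ ^ (n - 1)) ∘ₗ
          (ExteriorAlgebra.ι ℂ : Module.Dual ℂ V →ₗ[ℂ] _)) ∧
      LinearMap.range
          (LinearMap.mulLeft ℂ (σ ^ (n - 1)) ∘ₗ
            (ExteriorAlgebra.ι ℂ : Module.Dual ℂ V →ₗ[ℂ] _)) =
        ⋀[ℂ]^(2 * n - 1) (Module.Dual ℂ V) := by
  have hinj : Function.Injective
        (LinearMap.mulLeft ℂ (σ ^ (n - 1)) ∘ₗ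
          (ExteriorAlgebra.ι ℂ : Module.Dual ℂ V →ₗ[ℂ] _)) := by
    rw [← LinearMap.ker_eq_bot, LinearMap.ker_eq_bot']
    intro f hf
    replace hf : σ ^ (n - 1) * ι ℂ f = 0 := hf
    ext v
    have hc : ∀ k : ℕ, WedgeAux.con v (σ ^ k * ι ℂ f) =
        WedgeAux.con v (σ ^ k) * ι ℂ f + f v • σ ^ k := by
      intro k
      induction k with
      | zero =>
        have := WedgeAux.con_algebraMap v 1
        rw [map_one] at this
        simp [WedgeAux.con_iota, this, Algebra.algebraMap_eq_smul_one]
      | succ k ih =>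
        rw [pow_succ', mul_assoc, WedgeAux.con_two_mul v hσ, ih, WedgeAux.con_two_mul v hσ,
          add_mul, mul_add, mul_smul_comm]
        simp only [mul_assoc, add_assoc]
    have h2 := hc n
    have h3 : σ ^ n * ι ℂ f = 0 := by
      obtain ⟨m, rfl⟩ : ∃ m, n = m + 1 := ⟨n - 1, by omega⟩
      rw [pow_succ', mul_assoc]
      simp only [Nat.add_sub_cancel] at hf
      rw [hf, mul_zero]
    have h4 : WedgeAux.con v (σ ^ n) * ι ℂ f = 0 := by
      obtain ⟨m, rfl⟩ : ∃ m, n = m + 1 := ⟨n - 1, by omega⟩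
      simp only [Nat.add_sub_cancel] at hf
      rw [WedgeAux.con_pow v hσ, smul_mul_assoc, mul_assoc, hf, mul_zero, smul_zero]
    rw [h3, map_zero, h4, zero_add] at h2
    exact (smul_eq_zero.1 h2.symm).resolve_right
      (WedgeAux.pow_ne_zero' n hdim hσ hnd n le_rfl)
  refine ⟨hinj, Submodule.eq_of_le_of_finrank_eq ?_ ?_⟩
  · rintro _ ⟨f, rfl⟩
    have h := WedgeAux.pow_mem hσ (n - 1)
    have e : 2 * n - 1 = 2 * (n - 1) + 1 := by omega
    unfold exteriorPower at *
    rw [e, pow_succ]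
    exact Submodule.mul_mem_mul h ⟨f, rfl⟩
  · rw [LinearMap.finrank_range_of_inj hinj, exteriorPower.finrank_eq, Subspace.dual_finrank_eq,
      hdim, Nat.choose_symm_of_eq_add (show 2 * n = (2 * n - 1) + 1 by omega), Nat.choose_one_right]
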